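/- arXiv:2408.14126 — 3 statements merged into one kernel-verified Lean document; each statement's English description precedes it below -/
import Mathlib

section
/- Let Y, Ŷ, A be random variables on a finite probability space (taking values in finite types), with the distribution of (Y, Ŷ, A) given by a probability mass function. If the Sufficiency rule holds (Y is conditionally independent of A given Ŷ) and the Independence rule holds (Ŷ is independent of A), then Y is independent of A. Consequently, if Y is not independent of A (i.e., the sensitive groups have distinct label distributions), Sufficiency and Independence cannot both hold. -/
/-- The mass of an event is the sum of its masses over the fibres of a map. -/
theorem sum_ite_eq_sum_fiberwise {α β M : Type*} [Fintype α] [Fintype β] [DecidableEq β]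
    [AddCommMonoid M] (f : α → M) (g : α → β) (P : α → Prop) [DecidablePred P] :
    (∑ x, if P x then f x else 0) = ∑ b, ∑ x, if g x = b ∧ P x then f x else 0 := by
  rw [Finset.sum_comm]
  refine Finset.sum_congr rfl fun x _ => ?_
  simp [ite_and]

/-- An event contained in a null event is null. -/
theorem sum_ite_eq_zero_of_imp {α M : Type*} [Fintype α] [AddCommMonoid M] [PartialOrder M]
    [IsOrderedAddMonoid M] {f : α → M} (hf : ∀ x, 0 ≤ f x) {P Q : α → Prop}
    [DecidablePred P] [DecidablePred Q] (hPQ : ∀ x, P x → Q x)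
    (hQ : (∑ x, if Q x then f x else 0) = 0) : (∑ x, if P x then f x else 0) = 0 := by
  rw [← Finset.sum_filter, Finset.sum_eq_zero_iff_of_nonneg fun x _ => hf x] at hQ ⊢
  intro x hx
  exact hQ x (by simpa using hPQ x (by simpa using hx))


/-- For random variables `Y`, `Ŷ`, `A` on a finite probability space with joint
probability mass function `p` on `𝓨 × 𝓨' × 𝓐`: if the Sufficiency rule holds
(`Y ⊥ A | Ŷ`, expressed via conditional probabilities whenever `P(Ŷ = yh) > 0`) and the
Independence rule holds (`Ŷ ⊥ A`), then `Y` is independent of `A`.  Consequently, if `Y` is not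
independent of `A`, Sufficiency and Independence cannot both hold. -/
theorem sufficiency_and_independence_imply_label_independence
    {𝓨 𝓨' 𝓐 : Type*} [Fintype 𝓨] [Fintype 𝓨'] [Fintype 𝓐]
    [DecidableEq 𝓨] [DecidableEq 𝓨'] [DecidableEq 𝓐]
    (p : 𝓨 × 𝓨' × 𝓐 → ℝ)
    (hp_nonneg : ∀ x, 0 ≤ p x)
    (hp_sum : ∑ x : 𝓨 × 𝓨' × 𝓐, p x = 1)
    -- Sufficiency rule: Y ⊥ A | Ŷ
    (hsuff : ∀ yh : 𝓨',
      0 < (∑ x : 𝓨 × 𝓨' × 𝓐, if x.2.1 = yh then p x else 0) →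
      ∀ (y : 𝓨) (a : 𝓐),
        (∑ x : 𝓨 × 𝓨' × 𝓐, if x.1 = y ∧ x.2.1 = yh ∧ x.2.2 = a then p x else 0) /
            (∑ x : 𝓨 × 𝓨' × 𝓐, if x.2.1 = yh then p x else 0)
          = ((∑ x : 𝓨 × 𝓨' × 𝓐, if x.1 = y ∧ x.2.1 = yh then p x else 0) /
              (∑ x : 𝓨 × 𝓨' × 𝓐, if x.2.1 = yh then p x else 0)) *
            ((∑ x : 𝓨 × 𝓨' × 𝓐, if x.2.1 = yh ∧ x.2.2 = a then p x else 0) /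
              (∑ x : 𝓨 × 𝓨' × 𝓐, if x.2.1 = yh then p x else 0)))
    -- Independence rule: Ŷ ⊥ A
    (hind : ∀ (yh : 𝓨') (a : 𝓐),
      (∑ x : 𝓨 × 𝓨' × 𝓐, if x.2.1 = yh ∧ x.2.2 = a then p x else 0)
        = (∑ x : 𝓨 × 𝓨' × 𝓐, if x.2.1 = yh then p x else 0) *
          (∑ x : 𝓨 × 𝓨' × 𝓐, if x.2.2 = a then p x else 0)) :
    -- Conclusion: Y ⊥ A
    ∀ (y : 𝓨) (a : 𝓐),
      (∑ x : 𝓨 × 𝓨' × 𝓐, if x.1 = y ∧ x.2.2 = a then p x else 0)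
        = (∑ x : 𝓨 × 𝓨' × 𝓐, if x.1 = y then p x else 0) *
          (∑ x : 𝓨 × 𝓨' × 𝓐, if x.2.2 = a then p x else 0) := by
  intro y a
  have joint_eq_mul (yh : 𝓨') :
      (∑ x : 𝓨 × 𝓨' × 𝓐, if x.2.1 = yh ∧ x.1 = y ∧ x.2.2 = a then p x else 0)
        = (∑ x : 𝓨 × 𝓨' × 𝓐, if x.2.1 = yh ∧ x.1 = y then p x else 0) *
          (∑ x : 𝓨 × 𝓨' × 𝓐, if x.2.2 = a then p x else 0) := by
    have hnonneg : 0 ≤ ∑ x : 𝓨 × 𝓨' × 𝓐, if x.2.1 = yh then p x else 0 :=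
      Finset.sum_nonneg fun x _ => ite_nonneg (hp_nonneg x) le_rfl
    rcases hnonneg.eq_or_lt with hzero | hpos
    · rw [sum_ite_eq_zero_of_imp hp_nonneg (fun x hx => hx.1) hzero.symm,
        sum_ite_eq_zero_of_imp hp_nonneg (fun x hx => hx.1) hzero.symm, zero_mul]
    · have h := hsuff yh hpos y a
      rw [hind, mul_div_cancel_left₀ _ hpos.ne', div_mul_eq_mul_div,
        div_left_inj' hpos.ne'] at h
      simpa only [and_left_comm, and_comm] using h
  rw [sum_ite_eq_sum_fiberwise p (fun x => x.2.1) (fun x => x.1 = y ∧ x.2.2 = a),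
    sum_ite_eq_sum_fiberwise p (fun x => x.2.1) (fun x => x.1 = y), Finset.sum_mul]
  exact Finset.sum_congr rfl fun yh _ => joint_eq_mul yh
end

section
/- Let Y, S, A be random variables on a finite probability space whose joint probability mass function is strictly positive (P(Y=y, S=s, A=a) > 0 for all values y, s, a in the respective finite types). If the Sufficiency rule holds (Y is conditionally independent of A given S) and the Separation rule holds (S is conditionally independent of A given Y), then Y is independent of A. Consequently, if Y is not independent of A, Separation and Sufficiency cannot both be achieved. -/
theorem sum_ite_pos_of_pos {α : Type*} [Fintype α] {p : α → ℝ} (hp : ∀ x, 0 < p x)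
    (q : α → Prop) [DecidablePred q] {x₀ : α} (hx₀ : q x₀) :
    0 < ∑ x, if q x then p x else 0 := by
  refine Finset.sum_pos' (fun x _ => ?_) ⟨x₀, Finset.mem_univ _, by simpa [hx₀] using hp x₀⟩
  split_ifs
  exacts [(hp x).le, le_rfl]

/-- For random variables `Y`, `S`, `A` on a finite probability space whose joint
probability mass function is strictly positive: if the Sufficiency rule holds (`Y ⊥ A | S`) and
the Separation rule holds (`S ⊥ A | Y`), then `Y` is independent of `A`.  Consequently, if `Y` is
not independent of `A`, Separation and Sufficiency cannot both be achieved. -/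
theorem separation_and_sufficiency_imply_label_independence
    {𝓨 𝓢 𝓐 : Type*} [Fintype 𝓨] [Fintype 𝓢] [Fintype 𝓐]
    [DecidableEq 𝓨] [DecidableEq 𝓢] [DecidableEq 𝓐]
    (p : 𝓨 × 𝓢 × 𝓐 → ℝ)
    (hp_pos : ∀ x, 0 < p x)
    (hp_sum : ∑ x : 𝓨 × 𝓢 × 𝓐, p x = 1)
    -- Sufficiency rule: Y ⊥ A | S
    (hsuff : ∀ (s : 𝓢) (y : 𝓨) (a : 𝓐),
      (∑ x : 𝓨 × 𝓢 × 𝓐, if x.1 = y ∧ x.2.1 = s ∧ x.2.2 = a then p x else 0) /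
          (∑ x : 𝓨 × 𝓢 × 𝓐, if x.2.1 = s then p x else 0)
        = ((∑ x : 𝓨 × 𝓢 × 𝓐, if x.1 = y ∧ x.2.1 = s then p x else 0) /
            (∑ x : 𝓨 × 𝓢 × 𝓐, if x.2.1 = s then p x else 0)) *
          ((∑ x : 𝓨 × 𝓢 × 𝓐, if x.2.1 = s ∧ x.2.2 = a then p x else 0) /
            (∑ x : 𝓨 × 𝓢 × 𝓐, if x.2.1 = s then p x else 0)))
    -- Separation rule: S ⊥ A | Y
    (hsep : ∀ (y : 𝓨) (s : 𝓢) (a : 𝓐),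
      (∑ x : 𝓨 × 𝓢 × 𝓐, if x.1 = y ∧ x.2.1 = s ∧ x.2.2 = a then p x else 0) /
          (∑ x : 𝓨 × 𝓢 × 𝓐, if x.1 = y then p x else 0)
        = ((∑ x : 𝓨 × 𝓢 × 𝓐, if x.1 = y ∧ x.2.1 = s then p x else 0) /
            (∑ x : 𝓨 × 𝓢 × 𝓐, if x.1 = y then p x else 0)) *
          ((∑ x : 𝓨 × 𝓢 × 𝓐, if x.1 = y ∧ x.2.2 = a then p x else 0) /
            (∑ x : 𝓨 × 𝓢 × 𝓐, if x.1 = y then p x else 0))) :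
    -- Conclusion: Y ⊥ A
    ∀ (y : 𝓨) (a : 𝓐),
      (∑ x : 𝓨 × 𝓢 × 𝓐, if x.1 = y ∧ x.2.2 = a then p x else 0)
        = (∑ x : 𝓨 × 𝓢 × 𝓐, if x.1 = y then p x else 0) *
          (∑ x : 𝓨 × 𝓢 × 𝓐, if x.2.2 = a then p x else 0) := by
  intro y a
  have cross (s : 𝓢) :
      (∑ x : 𝓨 × 𝓢 × 𝓐, if x.1 = y ∧ x.2.2 = a then p x else 0) *
          (∑ x : 𝓨 × 𝓢 × 𝓐, if x.2.1 = s then p x else 0)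
        = (∑ x : 𝓨 × 𝓢 × 𝓐, if x.1 = y then p x else 0) *
          (∑ x : 𝓨 × 𝓢 × 𝓐, if x.2.1 = s ∧ x.2.2 = a then p x else 0) := by
    have hS := sum_ite_pos_of_pos hp_pos (fun x => x.2.1 = s) (x₀ := (y, s, a)) rfl
    have hY := sum_ite_pos_of_pos hp_pos (fun x => x.1 = y) (x₀ := (y, s, a)) rfl
    have hYS := sum_ite_pos_of_pos hp_pos (fun x => x.1 = y ∧ x.2.1 = s)
      (x₀ := (y, s, a)) ⟨rfl, rfl⟩
    have h₁ := hsuff s y a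
    have h₂ := hsep y s a
    field_simp at h₁ h₂
    refine mul_left_cancel₀ hYS.ne' ?_
    linear_combination (∑ x : 𝓨 × 𝓢 × 𝓐, if x.1 = y then p x else 0) * h₁ -
      (∑ x : 𝓨 × 𝓢 × 𝓐, if x.2.1 = s then p x else 0) * h₂
  have hsum := Finset.sum_congr (rfl : (Finset.univ : Finset 𝓢) = _) fun s _ => cross s
  rw [← Finset.mul_sum, ← Finset.mul_sum, Finset.sum_comm,
    Finset.sum_comm (s := (Finset.univ : Finset 𝓢))] at hsum
  simpa [ite_and, hp_sum] using hsum
end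

section
/- (Proposition 1) Let Z be a random variable taking values in a finite type, Y a real-valued (e.g., {0,1}-valued) random variable, and D0, D1 two sub-group distributions over (Z, Y) such that every value z has positive probability under both. Suppose there is a single function h* such that for every z, E_{D0}[Y | Z=z] = E_{D1}[Y | Z=z] = h*(z) (the optimal predictor is shared by both sub-groups). Define the prediction Ŷ = h*(Z). Then for every t in the range of h* with positive probability in both sub-groups, E_{D0}[Y | Ŷ = t] = E_{D1}[Y | Ŷ = t] = t; in particular the Sufficiency rule E_{D0}[Y | Ŷ=t] = E_{D1}[Y | Ŷ=t] holds. -/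
/-- The mass of a fibre of `h ∘ Z` is the sum of the masses of the fibres of `Z` it contains. -/
theorem sum_ite_comp_eq_sum_fiberwise
    {Ω 𝓩 β M : Type*} [Fintype Ω] [Fintype 𝓩] [DecidableEq 𝓩] [DecidableEq β] [AddCommMonoid M]
    (f : Ω → M) (Z : Ω → 𝓩) (h : 𝓩 → β) (t : β) :
    (∑ ω, if h (Z ω) = t then f ω else 0) =
      ∑ z, if h z = t then ∑ ω, if Z ω = z then f ω else 0 else 0 := by
  rw [← Finset.sum_filter (fun z => h z = t) (fun z => ∑ ω, if Z ω = z then f ω else 0),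
    Finset.sum_comm]
  simp

/-- A predictor that equals the conditional expectation of `Y` given `Z` is calibrated. -/
theorem condExp_given_prediction_eq
    {Ω 𝓩 𝕜 : Type*} [Fintype Ω] [Fintype 𝓩] [DecidableEq 𝓩] [Field 𝕜] [DecidableEq 𝕜]
    (p Y : Ω → 𝕜) (Z : Ω → 𝓩) (h : 𝓩 → 𝕜)
    (hZ : ∀ z, (∑ ω, if Z ω = z then p ω else 0) ≠ 0)
    (hh : ∀ z, (∑ ω, if Z ω = z then Y ω * p ω else 0) / (∑ ω, if Z ω = z then p ω else 0) = h z)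
    (t : 𝕜) (ht : (∑ ω, if h (Z ω) = t then p ω else 0) ≠ 0) :
    (∑ ω, if h (Z ω) = t then Y ω * p ω else 0) / (∑ ω, if h (Z ω) = t then p ω else 0) = t := by
  rw [div_eq_iff ht, sum_ite_comp_eq_sum_fiberwise (fun ω => Y ω * p ω) Z,
    sum_ite_comp_eq_sum_fiberwise p Z, Finset.mul_sum]
  refine Finset.sum_congr rfl fun z _ => ?_
  split_ifs with hz
  · rw [← hz, (div_eq_iff (hZ z)).1 (hh z)]
  · rw [mul_zero]

/-- **Proposition 1.** Let `Z` be a random variable taking values in a finite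
type, `Y` a real-valued random variable, and `D0`, `D1` two sub-group distributions (given by
mass functions `p0`, `p1` on a finite sample space `Ω`) such that every value `z` has positive
probability under both.  Suppose there is a single function `h*` such that for every `z`,
`E_{D0}[Y | Z=z] = E_{D1}[Y | Z=z] = h*(z)` (the optimal predictor is shared by both
sub-groups).  Define the prediction `Ŷ = h*(Z)`.  Then for every `t` in the range of `h*` with
positive probability in both sub-groups, `E_{D0}[Y | Ŷ=t] = E_{D1}[Y | Ŷ=t] = t`; in particular
the Sufficiency rule `E_{D0}[Y | Ŷ=t] = E_{D1}[Y | Ŷ=t]` holds. -/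
theorem invariant_predictor_implies_sufficiency
    {Ω 𝓩 : Type*} [Fintype Ω] [Fintype 𝓩] [DecidableEq 𝓩]
    (p0 p1 : Ω → ℝ) (Y : Ω → ℝ) (Z : Ω → 𝓩)
    (hp0_nonneg : ∀ ω, 0 ≤ p0 ω) (hp0_sum : ∑ ω : Ω, p0 ω = 1)
    (hp1_nonneg : ∀ ω, 0 ≤ p1 ω) (hp1_sum : ∑ ω : Ω, p1 ω = 1)
    (hZ0 : ∀ z : 𝓩, 0 < ∑ ω : Ω, if Z ω = z then p0 ω else 0)
    (hZ1 : ∀ z : 𝓩, 0 < ∑ ω : Ω, if Z ω = z then p1 ω else 0)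
    (hstar : 𝓩 → ℝ)
    (hinv0 : ∀ z : 𝓩,
      (∑ ω : Ω, if Z ω = z then Y ω * p0 ω else 0) / (∑ ω : Ω, if Z ω = z then p0 ω else 0)
        = hstar z)
    (hinv1 : ∀ z : 𝓩,
      (∑ ω : Ω, if Z ω = z then Y ω * p1 ω else 0) / (∑ ω : Ω, if Z ω = z then p1 ω else 0)
        = hstar z) :
    ∀ t : ℝ,
      0 < (∑ ω : Ω, if hstar (Z ω) = t then p0 ω else 0) →
      0 < (∑ ω : Ω, if hstar (Z ω) = t then p1 ω else 0) →
      (∑ ω : Ω, if hstar (Z ω) = t then Y ω * p0 ω else 0) /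
          (∑ ω : Ω, if hstar (Z ω) = t then p0 ω else 0) = t ∧
      (∑ ω : Ω, if hstar (Z ω) = t then Y ω * p1 ω else 0) /
          (∑ ω : Ω, if hstar (Z ω) = t then p1 ω else 0) = t := by
  intro t ht0 ht1
  exact ⟨condExp_given_prediction_eq p0 Y Z hstar (fun z => (hZ0 z).ne') hinv0 t ht0.ne',
    condExp_given_prediction_eq p1 Y Z hstar (fun z => (hZ1 z).ne') hinv1 t ht1.ne'⟩
end
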